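/- arXiv:2303.12607 — 2 statements merged into one kernel-verified Lean document; each statement's English description precedes it below -/
import Mathlib

section
/- Fix integers n ≥ 1 and k ≥ 1. The set of minimal elements of (U_5^{(k)}, ≥) is finite. -/
/-- The index `ind(A) = a^2 + 3a - ∑ (b_i^2 + b_i)` of a class
`A = aH - ∑ b_i E_i`, encoded as `A : ℕ → ℤ` with `A 0 = a` and `A i = b_i`
for `1 ≤ i ≤ n`. -/
def indCl (n : ℕ) (A : ℕ → ℤ) : ℤ :=
  (A 0) ^ 2 + 3 * A 0 - ∑ i ∈ Finset.Icc 1 n, ((A i) ^ 2 + A i)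

/-- The set `U_5^{(k)}` of classes `A = aH - ∑ b_i E_i` with `a > 0` and
`ind(A) ≥ 2k` (classes are supported on coordinates `0, …, n`). -/
def U5 (n k : ℕ) : Set (ℕ → ℤ) :=
  {A | 0 < A 0 ∧ 2 * (k : ℤ) ≤ indCl n A ∧ ∀ i, n < i → A i = 0}

/-- `ω_x(A) = a x_0 - ∑ b_i x_i`. -/
def omegaEval (n : ℕ) (x : ℕ → ℝ) (A : ℕ → ℤ) : ℝ :=
  (A 0 : ℝ) * x 0 - ∑ i ∈ Finset.Icc 1 n, (A i : ℝ) * x i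

/-- The `c_1`-nef cone `P^{c_1>0}` in `ℝ^{n+1}` (coordinates `x 0, …, x n`). -/
def c1Nef (n : ℕ) : Set (ℕ → ℝ) :=
  {x | 0 < 3 * x 0 - ∑ i ∈ Finset.Icc 1 n, x i ∧
    (if n = 1 then 0 < x 1 ∧ x 1 < x 0
     else if n = 2 then 0 < x 2 ∧ x 2 ≤ x 1 ∧ x 1 + x 2 < x 0
     else 0 < x n ∧ (∀ i j, 1 ≤ i → i ≤ j → j ≤ n → x j ≤ x i) ∧
          x 1 + x 2 + x 3 ≤ x 0 ∧ ∑ i ∈ Finset.Icc 1 n, (x i) ^ 2 < (x 0) ^ 2)}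

/-- The partial order on `U_5^{(k)}`: `A ≥ B` iff `ω_x(A) ≥ ω_x(B)` for all
`x` in the `c_1`-nef cone. -/
def geCl (n : ℕ) (A B : ℕ → ℤ) : Prop :=
  ∀ x ∈ c1Nef n, omegaEval n x B ≤ omegaEval n x A

/-- `A` is a minimal element of `(U_5^{(k)}, ≥)`. -/
def MinimalU5 (n k : ℕ) (A : ℕ → ℤ) : Prop :=
  A ∈ U5 n k ∧ ∀ B ∈ U5 n k, B ≠ A → ¬ geCl n A B

/-- The class with `H`-coefficient `c`, coefficients `u m` for `m ∈ T`, and zero elsewhere. -/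
def classOn (c : ℤ) (T : Finset ℕ) (u : ℕ → ℤ) : ℕ → ℤ :=
  fun m => if m = 0 then c else if m ∈ T then u m else 0

theorem omegaEval_sub (n : ℕ) (x : ℕ → ℝ) (A C : ℕ → ℤ) :
    omegaEval n x (A - C) = omegaEval n x A - omegaEval n x C := by
  simp only [omegaEval, Pi.sub_apply, Int.cast_sub, sub_mul, Finset.sum_sub_distrib]
  ring

theorem classOn_apply_of_mem {n : ℕ} {c : ℤ} {T : Finset ℕ} {u : ℕ → ℤ}
    (hT : T ⊆ Finset.Icc 1 n) {m : ℕ} (hm : m ∈ T) : classOn c T u m = u m := by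
  have := (Finset.mem_Icc.1 (hT hm)).1
  simp [classOn, hm, show m ≠ 0 by omega]

theorem classOn_apply_of_notMem {n : ℕ} {c : ℤ} {T : Finset ℕ} {u : ℕ → ℤ}
    {m : ℕ} (hm : m ∈ Finset.Icc 1 n) (hmT : m ∉ T) : classOn c T u m = 0 := by
  have := (Finset.mem_Icc.1 hm).1
  simp [classOn, hmT, show m ≠ 0 by omega]

theorem omegaEval_classOn {n : ℕ} (x : ℕ → ℝ) (c : ℤ) {T : Finset ℕ} (u : ℕ → ℤ)
    (hT : T ⊆ Finset.Icc 1 n) :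
    omegaEval n x (classOn c T u) = c * x 0 - ∑ m ∈ T, (u m : ℝ) * x m := by
  have h0 : classOn c T u 0 = c := by simp [classOn]
  rw [omegaEval, h0, ← Finset.sum_subset hT
    (fun m hm hmT => by simp [classOn_apply_of_notMem hm hmT])]
  congr 1
  exact Finset.sum_congr rfl fun m hm => by rw [classOn_apply_of_mem hT hm]

theorem indCl_sub_classOn {n : ℕ} (A : ℕ → ℤ) (c : ℤ) {T : Finset ℕ} (u : ℕ → ℤ)
    (hT : T ⊆ Finset.Icc 1 n) :
    indCl n (A - classOn c T u) = indCl n A - (2 * A 0 * c - c ^ 2 + 3 * c)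
      + ∑ m ∈ T, (2 * A m * u m - u m ^ 2 + u m) := by
  have h0 : classOn c T u 0 = c := by simp [classOn]
  have hs : ∑ m ∈ T, (2 * A m * u m - u m ^ 2 + u m) =
      ∑ m ∈ Finset.Icc 1 n, (((A m) ^ 2 + A m) -
        (((A - classOn c T u) m) ^ 2 + (A - classOn c T u) m)) := by
    rw [← Finset.sum_subset hT
      (fun m hm hmT => by simp [classOn_apply_of_notMem hm hmT])]
    refine Finset.sum_congr rfl fun m hm => ?_
    rw [Pi.sub_apply, classOn_apply_of_mem hT hm]
    ring
  rw [hs, Finset.sum_sub_distrib]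
  simp only [indCl, Pi.sub_apply, h0]
  ring

/-- Subtracting from a minimal element a nonzero class that is nonnegative on the `c_1`-nef cone
must leave `U_5^{(k)}`. -/
theorem MinimalU5.ind_sub_lt {n k : ℕ} {A : ℕ → ℤ} (h : MinimalU5 n k A) (c : ℤ) (T : Finset ℕ)
    (u : ℕ → ℤ) (hT : T ⊆ Finset.Icc 1 n) (hc : c < A 0) (hne : c ≠ 0 ∨ ∃ m ∈ T, u m ≠ 0)
    (hpos : ∀ x ∈ c1Nef n, ∑ m ∈ T, (u m : ℝ) * x m ≤ c * x 0) :
    indCl n A - (2 * A 0 * c - c ^ 2 + 3 * c)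
      + ∑ m ∈ T, (2 * A m * u m - u m ^ 2 + u m) < 2 * (k : ℤ) := by
  by_contra hcon
  push Not at hcon
  rw [← indCl_sub_classOn A c u hT] at hcon
  refine h.2 (A - classOn c T u) ⟨?_, hcon, ?_⟩ ?_ ?_
  · simp [classOn, hc]
  · intro i hi
    have hiT : i ∉ T := fun hm => by have := (Finset.mem_Icc.1 (hT hm)).2; omega
    simp [classOn, hiT, h.1.2.2 i hi, show i ≠ 0 by omega]
  · intro he
    have hz : classOn c T u = 0 := by simpa using he
    rcases hne with hne | ⟨m, hm, hne⟩
    · exact hne (by simpa [classOn] using congrFun hz 0)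
    · exact hne (by rw [← classOn_apply_of_mem (c := c) (u := u) hT hm, hz]; rfl)
  · intro x hx
    rw [omegaEval_sub, omegaEval_classOn x c u hT]
    linarith [hpos x hx]

theorem c1Nef_antitone {n : ℕ} {x : ℕ → ℝ} (hx : x ∈ c1Nef n) {i j : ℕ} (hi : 1 ≤ i)
    (hij : i ≤ j) (hj : j ≤ n) : x j ≤ x i := by
  obtain ⟨-, h⟩ := hx
  split_ifs at h with h1 h2
  · obtain rfl : i = j := by omega
    exact le_rfl
  · obtain rfl | ⟨rfl, rfl⟩ : i = j ∨ (i = 1 ∧ j = 2) := by omega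
    · exact le_rfl
    · exact h.2.1
  · exact h.2.1 i j hi hij hj

theorem c1Nef_pos {n : ℕ} {x : ℕ → ℝ} (hx : x ∈ c1Nef n) {i : ℕ} (hi : 1 ≤ i)
    (hin : i ≤ n) : 0 < x i := by
  refine lt_of_lt_of_le ?_ (c1Nef_antitone hx hi hin le_rfl)
  obtain ⟨-, h⟩ := hx
  split_ifs at h with h1 h2
  · subst h1; exact h.1
  · subst h2; exact h.1
  · exact h.1

theorem c1Nef_reduced {n : ℕ} {x : ℕ → ℝ} (hn : 3 ≤ n) (hx : x ∈ c1Nef n) :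
    x 1 + x 2 + x 3 ≤ x 0 := by
  obtain ⟨-, h⟩ := hx
  rw [if_neg (by omega), if_neg (by omega)] at h
  exact h.2.2.1

theorem MinimalU5.nonneg {n k : ℕ} {A : ℕ → ℤ} (h : MinimalU5 n k A) {i : ℕ} (hi : 1 ≤ i) :
    0 ≤ A i := by
  by_cases hin : n < i
  · exact (h.1.2.2 i hin).ge
  push Not at hin
  by_contra hneg
  push Not at hneg
  have := h.ind_sub_lt 0 {i} (fun _ => 2 * A i + 1) (by simp [hi, hin]) h.1.1
    (Or.inr ⟨i, by simp, by omega⟩) (fun x hx => by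
      have h1 := c1Nef_pos hx hi hin
      have h2 : ((2 * A i + 1 : ℤ) : ℝ) ≤ 0 := by exact_mod_cast (by omega)
      rw [Finset.sum_singleton]
      simpa using mul_nonpos_of_nonpos_of_nonneg h2 h1.le)
  rw [Finset.sum_singleton] at this
  nlinarith [h.1.2.1]

theorem MinimalU5.antitone {n k : ℕ} {A : ℕ → ℤ} (h : MinimalU5 n k A) {i j : ℕ} (hi : 1 ≤ i)
    (hij : i ≤ j) : A j ≤ A i := by
  by_cases hjn : n < j
  · rw [h.1.2.2 j hjn]
    exact h.nonneg hi
  push Not at hjn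
  by_contra hlt
  push Not at hlt
  have hne : i ≠ j := by rintro rfl; omega
  have := h.ind_sub_lt 0 {i, j} (fun m => if m = i then A i - A j else A j - A i)
    (by intro m; simp only [Finset.mem_insert, Finset.mem_singleton, Finset.mem_Icc]; omega)
    h.1.1 (Or.inr ⟨i, by simp, by simp; omega⟩) (fun x hx => by
      have h1 := c1Nef_antitone hx hi hij hjn
      have h2 : (A i : ℝ) ≤ A j := by exact_mod_cast hlt.le
      rw [Finset.sum_pair hne]
      simp only [if_true, if_neg hne.symm]
      push_cast
      nlinarith)
  rw [Finset.sum_pair hne] at this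
  simp only [if_true, if_neg hne.symm] at this
  nlinarith [h.1.2.1]

theorem MinimalU5.ind_lt {n k : ℕ} {A : ℕ → ℤ} (hn : 1 ≤ n) (h : MinimalU5 n k A) :
    indCl n A < 2 * k + 2 * (A n + 1) := by
  have := h.ind_sub_lt 0 {n} (fun _ => -1) (by simp [hn]) h.1.1
    (Or.inr ⟨n, by simp, by simp⟩) (fun x hx => by
      have h1 := c1Nef_pos hx hn le_rfl
      rw [Finset.sum_singleton]
      push_cast
      linarith)
  rw [Finset.sum_singleton] at this
  linarith

theorem sum_Icc_one_eq_of_support {n : ℕ} {A : ℕ → ℤ} (hA : ∀ i, n < i → A i = 0) (g : ℤ → ℤ)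
    (hg : g 0 = 0) :
    ∑ i ∈ Finset.Icc 1 n, g (A i) = g (A 1) + g (A 2) + g (A 3) + g (A 4) + g (A 5) + g (A 6)
      + g (A 7) + g (A 8) + g (A 9) + ∑ i ∈ Finset.Icc 10 (n + 9), g (A i) := by
  have h1 : ∑ i ∈ Finset.Icc 1 n, g (A i) = ∑ i ∈ Finset.Icc 1 (n + 9), g (A i) := by
    refine Finset.sum_subset (Finset.Icc_subset_Icc_right (by omega)) fun m hm hmn => ?_
    rw [Finset.mem_Icc] at hm hmn
    rw [hA m (by omega), hg]
  have h2 : Finset.Icc 1 (n + 9) = Finset.Icc 1 9 ∪ Finset.Icc 10 (n + 9) := by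
    ext m
    simp only [Finset.mem_union, Finset.mem_Icc]
    omega
  have h3 : Disjoint (Finset.Icc 1 9) (Finset.Icc 10 (n + 9)) := by
    rw [Finset.disjoint_left]
    intro m
    simp only [Finset.mem_Icc]
    omega
  rw [h1, h2, Finset.sum_union h3]
  simp [Finset.sum_Icc_succ_top]

theorem MinimalU5.sum_le {n k : ℕ} {A : ℕ → ℤ} (h : MinimalU5 n k A) (ha : 3 < A 0) :
    ∑ i ∈ Finset.Icc 1 n, A i ≤ 3 * A 0 := by
  by_contra hlt
  push Not at hlt
  have := h.ind_sub_lt 3 (Finset.Icc 1 n) (fun _ => 1) subset_rfl ha (Or.inl (by norm_num))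
    (fun x hx => by
      have := hx.1
      push_cast
      simp only [one_mul]
      linarith)
  have hs : ∑ m ∈ Finset.Icc 1 n, (2 * A m * 1 - 1 ^ 2 + 1) = 2 * ∑ m ∈ Finset.Icc 1 n, A m := by
    rw [Finset.mul_sum]
    exact Finset.sum_congr rfl fun _ _ => by ring
  rw [hs] at this
  linarith [h.1.2.1]

theorem MinimalU5.sq_add_le {n k : ℕ} {A : ℕ → ℤ} (h : MinimalU5 n k A) {T : Finset ℕ}
    (hT : T ⊆ Finset.Icc 1 n) : ∑ i ∈ T, (A i ^ 2 + A i) ≤ A 0 ^ 2 + 3 * A 0 := by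
  have h1 := h.1.2.1
  have h2 : ∑ i ∈ T, (A i ^ 2 + A i) ≤ ∑ i ∈ Finset.Icc 1 n, (A i ^ 2 + A i) :=
    Finset.sum_le_sum_of_subset_of_nonneg hT fun i hi _ => by
      have := h.nonneg (Finset.mem_Icc.1 hi).1
      positivity
  simp only [indCl] at h1
  linarith

theorem MinimalU5.reduced {n k : ℕ} {A : ℕ → ℤ} (hn : 3 ≤ n) (h : MinimalU5 n k A)
    (ha : 9 < A 0) : A 1 + A 2 + A 3 ≤ A 0 := by
  by_contra hlt
  push Not at hlt
  have hT : ({1, 2, 3} : Finset ℕ) ⊆ Finset.Icc 1 n := by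
    intro m
    simp only [Finset.mem_insert, Finset.mem_singleton, Finset.mem_Icc]
    omega
  have h1 := h.nonneg (i := 1) (by norm_num)
  have h2 := h.nonneg (i := 2) (by norm_num)
  have h3 := h.nonneg (i := 3) (by norm_num)
  have hsq := h.sq_add_le hT
  have hs : ∀ f : ℕ → ℤ, ∑ m ∈ ({1, 2, 3} : Finset ℕ), f m = f 1 + f 2 + f 3 := by
    intro f
    simp [add_assoc]
  rw [hs] at hsq
  have hlt2 : A 1 + A 2 + A 3 < 2 * A 0 := by
    by_contra hge
    push Not at hge
    nlinarith [sq_nonneg (A 1 - A 2), sq_nonneg (A 1 - A 3), sq_nonneg (A 2 - A 3)]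
  have := h.ind_sub_lt (A 1 + A 2 + A 3 - A 0) {1, 2, 3} (fun _ => A 1 + A 2 + A 3 - A 0) hT
    (by linarith) (Or.inl (by omega)) (fun x hx => by
      have hr := c1Nef_reduced hn hx
      have ht : (0 : ℝ) ≤ ((A 1 + A 2 + A 3 - A 0 : ℤ) : ℝ) := by exact_mod_cast (by omega)
      rw [← Finset.mul_sum]
      refine mul_le_mul_of_nonneg_left ?_ ht
      simpa [add_assoc] using hr)
  rw [hs] at this
  nlinarith [h.1.2.1]

theorem MinimalU5.ind_lt_of_nine_le {n k : ℕ} {A : ℕ → ℤ} (hn : 9 ≤ n) (h : MinimalU5 n k A)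
    (ha : 3 < A 0) :
    indCl n A < 2 * k + 2 * (3 * A 0 - (A 1 + A 2 + A 3 + A 4 + A 5 + A 6 + A 7 + A 8 + A 9)) := by
  have := h.ind_sub_lt 3 (Finset.Icc 1 9) (fun _ => 1) (Finset.Icc_subset_Icc_right hn) ha
    (Or.inl (by norm_num)) (fun x hx => by
      have hr := c1Nef_reduced (by omega) hx
      have h3 : ∀ j, 3 ≤ j → j ≤ 9 → x j ≤ x 3 := fun j hj hj' =>
        c1Nef_antitone hx (by norm_num) hj (by omega)
      have h12 : x 2 ≤ x 1 := c1Nef_antitone hx (by norm_num) (by norm_num) (by omega)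
      have h23 : x 3 ≤ x 2 := c1Nef_antitone hx (by norm_num) (by norm_num) (by omega)
      simp only [Finset.sum_Icc_succ_top, Nat.reduceLeDiff, Nat.reduceAdd, Finset.Icc_self,
        Finset.sum_singleton, Int.cast_one, one_mul, Int.cast_ofNat]
      linarith [h3 4 (by norm_num) (by norm_num), h3 5 (by norm_num) (by norm_num),
        h3 6 (by norm_num) (by norm_num), h3 7 (by norm_num) (by norm_num),
        h3 8 (by norm_num) (by norm_num), h3 9 (by norm_num) (by norm_num)])
  simp [Finset.sum_Icc_succ_top] at this
  linarith

theorem sq_le_mul_of_le {p q : ℤ} (hp : 0 ≤ p) (hpq : p ≤ q) : p ^ 2 ≤ q * p := by nlinarith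

/-- Bound on a reduced class with at most eight exceptional terms. -/
theorem reduced_sq_le {p q₁ q₂ q₃ q₄ q₅ q₆ q₇ q₈ : ℤ} (h : q₁ + q₂ + q₃ ≤ p) (h12 : q₂ ≤ q₁)
    (h23 : q₃ ≤ q₂) (h34 : q₄ ≤ q₃) (h45 : q₅ ≤ q₄) (h56 : q₆ ≤ q₅) (h67 : q₇ ≤ q₆)
    (h78 : q₈ ≤ q₇) (h8 : 0 ≤ q₈) :
    q₃ ^ 2 + (q₁ ^ 2 + q₂ ^ 2 + q₃ ^ 2 + q₄ ^ 2 + q₅ ^ 2 + q₆ ^ 2 + q₇ ^ 2 + q₈ ^ 2) ≤ p ^ 2 := by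
  have e4 : q₄ ^ 2 ≤ q₃ ^ 2 := pow_le_pow_left₀ (by linarith) (by linarith) 2
  have e5 : q₅ ^ 2 ≤ q₃ ^ 2 := pow_le_pow_left₀ (by linarith) (by linarith) 2
  have e6 : q₆ ^ 2 ≤ q₃ ^ 2 := pow_le_pow_left₀ (by linarith) (by linarith) 2
  have e7 : q₇ ^ 2 ≤ q₃ ^ 2 := pow_le_pow_left₀ (by linarith) (by linarith) 2
  have e8 : q₈ ^ 2 ≤ q₃ ^ 2 := pow_le_pow_left₀ (by linarith) (by linarith) 2
  have ep : (q₁ + q₂ + q₃) ^ 2 ≤ p ^ 2 := pow_le_pow_left₀ (by linarith) h 2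
  have m12 : q₃ * q₃ ≤ q₁ * q₂ := mul_le_mul (by linarith) h23 (by linarith) (by linarith)
  have m13 : q₃ * q₃ ≤ q₁ * q₃ := mul_le_mul (by linarith) le_rfl (by linarith) (by linarith)
  have m23 : q₃ * q₃ ≤ q₂ * q₃ := mul_le_mul (by linarith) le_rfl (by linarith) (by linarith)
  nlinarith

/-- The `H`-coefficient of a minimal element is bounded for `n = 1`. -/
theorem MinimalU5.apply_zero_le_of_eq_one {k : ℕ} {A : ℕ → ℤ} (h : MinimalU5 1 k A) :
    A 0 ≤ 4 * k + 4 := by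
  have h1 := h.nonneg (i := 1) le_rfl
  have h2 := h.ind_lt le_rfl
  have h3 := h.1.2.1
  have h0 := h.1.1
  by_contra hbig
  push Not at hbig
  have h4 := h.ind_sub_lt 1 {1} (fun _ => 1) (by simp) (by omega)
    (Or.inl (by norm_num)) (fun x hx => by
      have hx1 := hx.2
      rw [if_pos rfl] at hx1
      simp [hx1.2.le])
  simp only [Finset.sum_singleton] at h4
  simp only [indCl, Finset.Icc_self, Finset.sum_singleton] at h2 h3 h4
  have hle : A 1 ≤ A 0 := by
    by_contra hlt
    push Not at hlt
    nlinarith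
  obtain ⟨d, hd⟩ : ∃ d, A 0 = A 1 + d := ⟨A 0 - A 1, by ring⟩
  rw [hd] at h2 h3 h4 hbig
  have hd0 : 0 ≤ d := by omega
  rcases hd0.eq_or_lt with hd0 | hd0
  · subst hd0
    nlinarith
  · nlinarith

theorem MinimalU5.apply_zero_le_of_eq_two {k : ℕ} {A : ℕ → ℤ} (h : MinimalU5 2 k A) :
    A 0 ≤ k + 4 := by
  have h2 := h.nonneg (i := 2) (by norm_num)
  have h12 := h.antitone (i := 1) (j := 2) le_rfl (by norm_num)
  have hlt := h.ind_lt (by norm_num)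
  have hs : ∀ f : ℕ → ℤ, ∑ m ∈ Finset.Icc 1 2, f m = f 1 + f 2 := by
    intro f
    simp [Finset.sum_Icc_succ_top]
  by_contra hbig
  push Not at hbig
  have h4 := h.ind_sub_lt 1 (Finset.Icc 1 2) (fun _ => 1) subset_rfl (by omega)
    (Or.inl (by norm_num)) (fun x hx => by
      have hx1 := hx.2
      rw [if_neg (by norm_num), if_pos rfl] at hx1
      simpa [Finset.sum_Icc_succ_top] using hx1.2.2.le)
  have h3 := h.1.2.1
  rw [hs] at h4
  have hr : A 1 + A 2 ≤ A 0 := by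
    by_contra hgt
    push Not at hgt
    linarith
  simp only [indCl, hs] at hlt
  nlinarith [sq_nonneg (A 2 - 1)]

theorem MinimalU5.apply_zero_le {n k : ℕ} {A : ℕ → ℤ} (hn : 3 ≤ n) (h : MinimalU5 n k A) :
    A 0 ≤ 18 * k + 21 + 3 * (n + 1) * (2 * k + 1) := by
  by_contra hbig
  push Not at hbig
  have hK : (0 : ℤ) ≤ 3 * (n + 1) * (2 * k + 1) := by positivity
  have ha : 9 < A 0 := by linarith [Int.natCast_nonneg k]
  have hr := h.reduced hn ha
  have hF := h.sum_le (by omega)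
  have hlt := h.ind_lt (by omega)
  have hge := h.1.2.1
  have hsupp := h.1.2.2
  have hanti : ∀ i, 1 ≤ i → A (i + 1) ≤ A i := fun i hi => h.antitone hi (by omega)
  have h12 := hanti 1 (by norm_num)
  have h23 := hanti 2 (by norm_num)
  have h34 := hanti 3 (by norm_num)
  have h45 := hanti 4 (by norm_num)
  have h56 := hanti 5 (by norm_num)
  have h67 := hanti 6 (by norm_num)
  have h78 := hanti 7 (by norm_num)
  have h89 := hanti 8 (by norm_num)
  have h910 := hanti 9 (by norm_num)
  norm_num at h12 h23 h34 h45 h56 h67 h78 h89 h910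
  have h10 := h.nonneg (i := 10) (by norm_num)
  have hnn := h.nonneg (i := n) (by omega)
  have hF' := sum_Icc_one_eq_of_support hsupp id rfl
  simp only [id] at hF'
  have hsq := sum_Icc_one_eq_of_support hsupp (fun z => z ^ 2) (by norm_num)
  have hind : indCl n A = A 0 ^ 2 + 3 * A 0 - ∑ i ∈ Finset.Icc 1 n, A i ^ 2
      - ∑ i ∈ Finset.Icc 1 n, A i := by
    rw [indCl, Finset.sum_add_distrib]
    ring
  rw [hind, hF', hsq] at hlt
  rw [hF'] at hF
  have hR0 : 0 ≤ ∑ i ∈ Finset.Icc 10 (n + 9), A i :=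
    Finset.sum_nonneg fun i hi => h.nonneg (by have := (Finset.mem_Icc.1 hi).1; omega)
  have hS : ∑ i ∈ Finset.Icc 10 (n + 9), A i ^ 2
      ≤ A 10 * ∑ i ∈ Finset.Icc 10 (n + 9), A i := by
    rw [Finset.mul_sum]
    refine Finset.sum_le_sum fun i hi => ?_
    have := (Finset.mem_Icc.1 hi).1
    exact sq_le_mul_of_le (h.nonneg (by omega)) (h.antitone (by norm_num) this)
  have hR : ∑ i ∈ Finset.Icc 10 (n + 9), A i ≤ n * A 10 := by
    have := Finset.sum_le_card_nsmul (Finset.Icc 10 (n + 9)) A (A 10) fun i hi =>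
      h.antitone (by norm_num) (Finset.mem_Icc.1 hi).1
    simpa using this
  by_cases hn9 : n < 9
  · have h9z : A 9 = 0 := hsupp 9 hn9
    have h10z : A 10 = 0 := hsupp 10 (by omega)
    have hred := reduced_sq_le hr h12 h23 h34 h45 h56 h67 h78 (by linarith)
    have hn3 : A n ≤ A 3 := h.antitone (by norm_num) hn
    rw [h10z] at hS hR
    rw [h9z] at hlt
    nlinarith [sq_nonneg (A 3 - 1)]
  · push Not at hn9
    have hG := h.ind_lt_of_nine_le hn9 (by omega)
    rw [hind, hF', hsq] at hG
    generalize ∑ i ∈ Finset.Icc 10 (n + 9), A i = R at *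
    generalize ∑ i ∈ Finset.Icc 10 (n + 9), A i ^ 2 = S at *
    have hred := reduced_sq_le (p := A 0 - 3 * A 9) (q₁ := A 1 - A 9) (q₂ := A 2 - A 9)
      (q₃ := A 3 - A 9) (q₄ := A 4 - A 9) (q₅ := A 5 - A 9) (q₆ := A 6 - A 9)
      (q₇ := A 7 - A 9) (q₈ := A 8 - A 9) (by linarith) (by linarith) (by linarith) (by linarith)
      (by linarith) (by linarith) (by linarith) (by linarith) (by linarith)
    obtain ⟨c, hc⟩ : ∃ c, c = 3 * A 0 -
      (A 1 + A 2 + A 3 + A 4 + A 5 + A 6 + A 7 + A 8 + A 9) := ⟨_, rfl⟩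
    have hRc : R ≤ c := by linarith
    have hSc : S ≤ A 9 * c := hS.trans (mul_le_mul h910 hRc hR0 (by linarith))
    have hself : A 9 * c ≤ A 0 ^ 2 - (A 1 ^ 2 + A 2 ^ 2 + A 3 ^ 2 + A 4 ^ 2 + A 5 ^ 2 + A 6 ^ 2
        + A 7 ^ 2 + A 8 ^ 2 + A 9 ^ 2 + S) := by
      have := sq_nonneg (A 3 - A 9)
      rw [hc] at hSc ⊢
      linarith
    have hc0 : 0 ≤ c := by linarith
    have hn9' : A n ≤ A 9 := h.antitone (by norm_num) hn9
    by_cases h9 : 2 * (k : ℤ) + 2 ≤ A 9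
    · rcases hc0.eq_or_lt with hc0 | hc0
      · rw [hind, hF', hsq] at hge
        linarith
      · have h9c : (2 * (k : ℤ) + 2) * c ≤ A 9 * c := mul_le_mul_of_nonneg_right h9 hc0.le
        have hkc : 2 * (k : ℤ) * 1 ≤ 2 * k * c :=
          mul_le_mul_of_nonneg_left hc0 (by positivity)
        linarith
    · push Not at h9
      have hnR : (n : ℤ) * A 10 ≤ n * (2 * k + 1) :=
        mul_le_mul_of_nonneg_left (by linarith) (by positivity)
      have hp : 0 ≤ A 9 * c := mul_nonneg (by linarith) hc0
      linarith

theorem finite_of_bounded_support {s : Set (ℕ → ℤ)} (n : ℕ) (K : ℤ)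
    (hs : ∀ A ∈ s, ∀ i, n < i → A i = 0) (hb : ∀ A ∈ s, ∀ i, 0 ≤ A i ∧ A i ≤ K) :
    s.Finite := by
  refine Set.Finite.of_finite_image (f := fun (A : ℕ → ℤ) (i : Fin (n + 1)) => A i) ?_ ?_
  · refine (Set.finite_Icc (0 : Fin (n + 1) → ℤ) (fun _ => K)).subset ?_
    rintro _ ⟨A, hA, rfl⟩
    exact ⟨fun i => (hb A hA i).1, fun i => (hb A hA i).2⟩
  · intro A hA B hB hAB
    funext i
    by_cases hi : n < i
    · rw [hs A hA i hi, hs B hB i hi]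
    · exact congrFun hAB ⟨i, by omega⟩

/-- The set of minimal elements of `(U_5^{(k)}, ≥)` is finite. -/
theorem minimal_elements_finite (n k : ℕ) (hn : 1 ≤ n) (hk : 1 ≤ k) :
    Set.Finite {A : ℕ → ℤ | MinimalU5 n k A} := by
  obtain ⟨K, hK⟩ : ∃ K : ℤ, ∀ A, MinimalU5 n k A → A 0 ≤ K := by
    obtain rfl | rfl | hn3 : n = 1 ∨ n = 2 ∨ 3 ≤ n := by omega
    · exact ⟨_, fun A h => h.apply_zero_le_of_eq_one⟩
    · exact ⟨_, fun A h => h.apply_zero_le_of_eq_two⟩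
    · exact ⟨_, fun A h => h.apply_zero_le hn3⟩
  refine finite_of_bounded_support n (K + 1) (fun A h => h.1.2.2) fun A h i => ?_
  have h0 := h.1.1
  have hA := hK A h
  rcases Nat.eq_zero_or_pos i with rfl | hi
  · exact ⟨h0.le, by linarith⟩
  · have hnn := h.nonneg hi
    refine ⟨hnn, ?_⟩
    by_cases hin : n < i
    · rw [h.1.2.2 i hin]
      linarith
    · have := h.sq_add_le (T := {i}) (by simp; omega)
      rw [Finset.sum_singleton] at this
      by_contra hlt
      push Not at hlt
      nlinarith
end

section
/- Fix integers n ≥ 1 and k ≥ 1, and let x = (x_0, x_1, ..., x_n) ∈ P^{c_1>0} ⊂ R^{n+1}. For an integer m ≥ 1 and y ∈ R^{m+1}, write F_{k,m}(y) = inf{ ω_y(A) : A ∈ U_5^{(k)}(m) }, where U_5^{(k)}(m) is the set U_5^{(k)} formed inside Z^{m+1}. Then lim_{ε→0+} F_{k,n+1}(x_0, x_1, ..., x_n, ε) = F_{k,n}(x_0, x_1, ..., x_n). (This is the small-blowup continuity of the k-th tamed capacity.) -/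
theorem sq_add_self_nonneg (b : ℤ) : 0 ≤ b ^ 2 + b := by
  rcases le_or_gt 0 b with h | h
  · positivity
  · nlinarith

theorem c1Nef_pos_and_sum_sq_lt {n : ℕ} (hn : 1 ≤ n) {x : ℕ → ℝ} (hx : x ∈ c1Nef n) :
    0 < x 0 ∧ ∑ i ∈ Finset.Icc 1 n, x i ^ 2 < x 0 ^ 2 := by
  obtain ⟨-, h⟩ := hx
  split_ifs at h with h1 h2
  · subst h1
    obtain ⟨ha, hb⟩ := h
    refine ⟨by linarith, ?_⟩
    simp only [Finset.Icc_self, Finset.sum_singleton]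
    nlinarith
  · subst h2
    obtain ⟨ha, hb, hc⟩ := h
    refine ⟨by linarith, ?_⟩
    rw [Finset.sum_Icc_succ_top (by norm_num)]
    simp only [Finset.Icc_self, Finset.sum_singleton]
    norm_num
    nlinarith
  · obtain ⟨ha, hb, hc, hd⟩ := h
    refine ⟨?_, hd⟩
    have h1 := hb 1 n le_rfl hn le_rfl
    have h2 := hb 2 n (by omega) (by omega) le_rfl
    have h3 := hb 3 n (by omega) (by omega) le_rfl
    linarith

/-- Coercivity of `ω_x` on classes with `a > 0` and nonnegative index, when `∑ x_i^2 < x_0^2`. -/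
theorem exists_linear_lower_bound (n : ℕ) {x : ℕ → ℝ} (h0 : 0 < x 0)
    (hx : ∑ i ∈ Finset.Icc 1 n, x i ^ 2 < x 0 ^ 2) :
    ∃ δ C : ℝ, 0 < δ ∧ ∀ A : ℕ → ℤ, 0 < A 0 → 0 ≤ indCl n A →
      δ * A 0 - C ≤ omegaEval n x A := by
  set r := √(∑ i ∈ Finset.Icc 1 n, x i ^ 2) with hr
  have hr0 : 0 ≤ r := Real.sqrt_nonneg _
  refine ⟨x 0 - r, (n + 2) * r - (∑ i ∈ Finset.Icc 1 n, x i) / 2,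
    sub_pos.2 ((Real.sqrt_lt' h0).2 hx), fun A hA hind => ?_⟩
  have hA' : (0 : ℝ) < A 0 := by exact_mod_cast hA
  have hind' : ∑ i ∈ Finset.Icc 1 n, ((A i : ℝ) ^ 2 + A i) ≤ (A 0 : ℝ) ^ 2 + 3 * A 0 := by
    unfold indCl at hind
    exact_mod_cast sub_nonneg.1 hind
  have hsq : ∑ i ∈ Finset.Icc 1 n, ((A i : ℝ) + 1 / 2) ^ 2 ≤ ((A 0 : ℝ) + (n + 2)) ^ 2 := by
    have e : ∑ i ∈ Finset.Icc 1 n, ((A i : ℝ) + 1 / 2) ^ 2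
        = ∑ i ∈ Finset.Icc 1 n, ((A i : ℝ) ^ 2 + A i) + n / 4 := by
      rw [Finset.sum_congr rfl fun i _ =>
        (by ring : ((A i : ℝ) + 1 / 2) ^ 2 = ((A i : ℝ) ^ 2 + A i) + 1 / 4),
        Finset.sum_add_distrib]
      simp only [Finset.sum_const, Nat.card_Icc, nsmul_eq_mul, add_tsub_cancel_right]
      ring
    have hn : (0 : ℝ) ≤ n := n.cast_nonneg
    rw [e]
    nlinarith [mul_nonneg hn hA'.le]
  have hcs : ∑ i ∈ Finset.Icc 1 n, ((A i : ℝ) + 1 / 2) * x i ≤ (A 0 + (n + 2)) * r := by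
    refine (Real.sum_mul_le_sqrt_mul_sqrt _ _ _).trans ?_
    exact mul_le_mul_of_nonneg_right ((Real.sqrt_le_left (by positivity)).2 hsq) hr0
  have e : ∑ i ∈ Finset.Icc 1 n, ((A i : ℝ) + 1 / 2) * x i
      = ∑ i ∈ Finset.Icc 1 n, (A i : ℝ) * x i + (∑ i ∈ Finset.Icc 1 n, x i) / 2 := by
    rw [Finset.sum_div, ← Finset.sum_add_distrib]
    exact Finset.sum_congr rfl fun i _ => by ring
  unfold omegaEval
  linarith

theorem indCl_succ (n : ℕ) (A : ℕ → ℤ) :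
    indCl (n + 1) A = indCl n A - (A (n + 1) ^ 2 + A (n + 1)) := by
  unfold indCl
  rw [Finset.sum_Icc_succ_top (by omega)]
  ring

theorem indCl_le (n : ℕ) (A : ℕ → ℤ) : indCl n A ≤ A 0 ^ 2 + 3 * A 0 :=
  sub_le_self _ (Finset.sum_nonneg fun _ _ => sq_add_self_nonneg _)

theorem indCl_congr {n : ℕ} {A B : ℕ → ℤ} (h : ∀ i ≤ n, A i = B i) : indCl n A = indCl n B := by
  unfold indCl
  rw [h 0 n.zero_le, Finset.sum_congr rfl fun i hi => by rw [h i (Finset.mem_Icc.1 hi).2]]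

theorem omegaEval_congr {n : ℕ} {x y : ℕ → ℝ} {A B : ℕ → ℤ} (hxy : ∀ i ≤ n, x i = y i)
    (h : ∀ i ≤ n, A i = B i) : omegaEval n x A = omegaEval n y B := by
  unfold omegaEval
  rw [h 0 n.zero_le, hxy 0 n.zero_le, Finset.sum_congr rfl fun i hi => by
    rw [h i (Finset.mem_Icc.1 hi).2, hxy i (Finset.mem_Icc.1 hi).2]]

theorem omegaEval_succ (n : ℕ) (x : ℕ → ℝ) (ε : ℝ) (A : ℕ → ℤ) :
    omegaEval (n + 1) (fun i => if i = n + 1 then ε else x i) A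
      = omegaEval n x A - A (n + 1) * ε := by
  rw [← omegaEval_congr (x := fun i => if i = n + 1 then ε else x i) (A := A)
    (fun i hi => if_neg (by omega)) fun _ _ => rfl]
  unfold omegaEval
  rw [Finset.sum_Icc_succ_top (by omega)]
  simp only [if_true]
  ring

theorem U5_subset_succ (n k : ℕ) : U5 n k ⊆ U5 (n + 1) k := by
  rintro A ⟨h0, hi, hs⟩
  refine ⟨h0, ?_, fun i h => hs i (by omega)⟩
  rw [indCl_succ, hs (n + 1) (by omega)]
  simpa using hi

theorem U5_nonempty (n : ℕ) {k : ℕ} (hk : 1 ≤ k) : (U5 n k).Nonempty := by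
  refine ⟨fun i => if i = 0 then (k : ℤ) else 0, ?_, ?_, fun i hi => if_neg (by omega)⟩
  · simpa using Nat.pos_of_ne_zero (by omega)
  · unfold indCl
    rw [Finset.sum_eq_zero fun i hi => by
      have : i ≠ 0 := by have := (Finset.mem_Icc.1 hi).1; omega
      simp [this]]
    simp only [if_true]
    nlinarith [sq_nonneg (k : ℤ)]

/-- Forgetting the last exceptional coordinate keeps a class in `U_5^{(k)}`. -/
theorem exists_mem_U5_omegaEval_eq {n k : ℕ} {A : ℕ → ℤ} (hA : A ∈ U5 (n + 1) k) (x : ℕ → ℝ) :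
    ∃ B ∈ U5 n k, B 0 = A 0 ∧ omegaEval n x B = omegaEval n x A := by
  obtain ⟨h0, hi, -⟩ := hA
  have hB : ∀ i ≤ n, (if i ≤ n then A i else 0) = A i := fun i hi => if_pos hi
  refine ⟨fun i => if i ≤ n then A i else 0, ⟨?_, ?_, fun i h => if_neg (by omega)⟩,
    hB 0 n.zero_le, omegaEval_congr (fun _ _ => rfl) hB⟩
  · exact h0.trans_eq (hB 0 n.zero_le).symm
  · rw [indCl_congr hB]
    rw [indCl_succ] at hi
    linarith [sq_add_self_nonneg (A (n + 1))]

theorem last_le_of_mem_U5 {n k : ℕ} {A : ℕ → ℤ} (hA : A ∈ U5 (n + 1) k) :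
    A (n + 1) ≤ A 0 + 1 := by
  obtain ⟨h0, hi, -⟩ := hA
  rw [indCl_succ] at hi
  have := indCl_le n A
  by_contra! h
  nlinarith

/-- Small-blowup continuity of the `k`-th tamed capacity: for `x ∈ P^{c_1>0}`,
`lim_{ε→0⁺} F_{k,n+1}(x_0, …, x_n, ε) = F_{k,n}(x_0, …, x_n)`, where
`F_{k,m}(y) = inf {ω_y(A) | A ∈ U_5^{(k)}(m)}`. -/
theorem blowup_continuity (n k : ℕ) (hn : 1 ≤ n) (hk : 1 ≤ k)
    (x : ℕ → ℝ) (hx : x ∈ c1Nef n) :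
    Filter.Tendsto
      (fun ε : ℝ =>
        sInf (omegaEval (n + 1) (fun i => if i = n + 1 then ε else x i) '' U5 (n + 1) k))
      (nhdsWithin 0 (Set.Ioi 0))
      (nhds (sInf (omegaEval n x '' U5 n k))) := by
  obtain ⟨h0, hsq⟩ := c1Nef_pos_and_sum_sq_lt hn hx
  obtain ⟨δ, C, hδ, hlow⟩ := exists_linear_lower_bound n h0 hsq
  set F := sInf (omegaEval n x '' U5 n k) with hF
  have hcoer : ∀ A ∈ U5 n k, δ * A 0 - C ≤ omegaEval n x A := fun A hA =>
    hlow A hA.1 (le_trans (by positivity) hA.2.1)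
  have hbdd : BddBelow (omegaEval n x '' U5 n k) := by
    refine ⟨-C, ?_⟩
    rintro _ ⟨A, hA, rfl⟩
    have : (0 : ℝ) < A 0 := by exact_mod_cast hA.1
    linarith [hcoer A hA, mul_pos hδ this]
  have hbound : ∀ ε : ℝ, 0 < ε → ε < δ → ∀ A ∈ U5 (n + 1) k,
      F * (1 - ε / δ) - ε * (C / δ + 1)
        ≤ omegaEval (n + 1) (fun i => if i = n + 1 then ε else x i) A := by
    intro ε hε hεδ A hA
    obtain ⟨B, hB, hB0, hBA⟩ := exists_mem_U5_omegaEval_eq hA x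
    have hFB : F ≤ omegaEval n x B := csInf_le hbdd ⟨B, hB, rfl⟩
    have hc := hcoer B hB
    rw [hBA] at hFB hc
    rw [hB0] at hc
    have hlast : (A (n + 1) : ℝ) ≤ A 0 + 1 := by exact_mod_cast last_le_of_mem_U5 hA
    have ha : (A 0 : ℝ) ≤ (omegaEval n x A + C) / δ := by
      rw [le_div_iff₀ hδ]
      linarith
    have hq : 0 ≤ 1 - ε / δ := by
      rw [sub_nonneg, div_le_one hδ]
      exact hεδ.le
    rw [omegaEval_succ]
    calc F * (1 - ε / δ) - ε * (C / δ + 1)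
        ≤ omegaEval n x A * (1 - ε / δ) - ε * (C / δ + 1) := by gcongr
      _ = omegaEval n x A - ((omegaEval n x A + C) / δ + 1) * ε := by ring
      _ ≤ omegaEval n x A - A (n + 1) * ε := by
        gcongr
        linarith
  have hlim : Filter.Tendsto (fun ε : ℝ => F * (1 - ε / δ) - ε * (C / δ + 1))
      (nhdsWithin 0 (Set.Ioi 0)) (nhds F) := by
    have hc : Continuous fun ε : ℝ => F * (1 - ε / δ) - ε * (C / δ + 1) := by fun_prop
    simpa using (hc.tendsto 0).mono_left nhdsWithin_le_nhds
  have hsmall : ∀ᶠ ε : ℝ in nhdsWithin 0 (Set.Ioi 0), 0 < ε ∧ ε < δ := Ioo_mem_nhdsGT hδ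
  refine tendsto_of_tendsto_of_tendsto_of_le_of_le' hlim tendsto_const_nhds ?_ ?_
  · filter_upwards [hsmall] with ε hε
    refine le_csInf ((U5_nonempty (n + 1) hk).image _) ?_
    rintro _ ⟨A, hA, rfl⟩
    exact hbound ε hε.1 hε.2 A hA
  · filter_upwards [hsmall] with ε hε
    refine le_csInf ((U5_nonempty n hk).image _) ?_
    rintro _ ⟨A, hA, rfl⟩
    refine csInf_le ⟨F * (1 - ε / δ) - ε * (C / δ + 1), ?_⟩ ⟨A, U5_subset_succ n k hA, ?_⟩
    · rintro _ ⟨B, hB, rfl⟩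
      exact hbound ε hε.1 hε.2 B hB
    · rw [omegaEval_succ, hA.2.2 (n + 1) (by omega)]
      simp
end
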